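/- Let x, y ∈ V be adjacent. If Π y = Π x + 1, then the matrix entry of the Hamiltonian satisfies H(x,y) = (1/deg₊(x))·(J δ_{Π x + 1})(Π x); if Π y = Π x − 1, then H(x,y) = (1/deg₋(x))·(J δ_{Π x − 1})(Π x). (Note deg₊(x) ≥ 1, resp. deg₋(x) ≥ 1, in the respective case since y is such a neighbor.) -/

import Mathlib

noncomputable section

/-- The transversal layer `Π⁻¹(n)` as a finset. -/
def layer {V : Type} [Fintype V] {N : ℕ} (proj : V → Fin (N + 1)) (n : Fin (N + 1)) :
    Finset V :=
  Finset.univ.filter (fun x => proj x = n)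

/-- The weight `μ(x) = 1/|Π⁻¹(Π x)|`. -/
def mu {V : Type} [Fintype V] {N : ℕ} (proj : V → Fin (N + 1)) (x : V) : ℂ :=
  ((layer proj (proj x)).card : ℂ)⁻¹

/-- The weighted inner product `⟨ψ,φ⟩_G = Σ_x ψ(x) conj(φ(x)) μ(x)` on `ℂ^V`. -/
def innerG {V : Type} [Fintype V] {N : ℕ} (proj : V → Fin (N + 1)) (ψ φ : V → ℂ) : ℂ :=
  ∑ x, ψ x * (starRingEnd ℂ) (φ x) * mu proj x

/-- The standard inner product on `ℂ^{0,…,N}`. -/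
def innerStd {N : ℕ} (ψ φ : Fin (N + 1) → ℂ) : ℂ :=
  ∑ n, ψ n * (starRingEnd ℂ) (φ n)

/-- The averaging map `P : ℂ^V → ℂ^{0,…,N}`. -/
def avg {V : Type} [Fintype V] {N : ℕ} (proj : V → Fin (N + 1)) (ψ : V → ℂ) :
    Fin (N + 1) → ℂ :=
  fun n => ((layer proj n).card : ℂ)⁻¹ * ∑ x ∈ layer proj n, ψ x

/-- The map `P* : ℂ^{0,…,N} → ℂ^V`, `(P*φ)(x) = φ(Π x)`. -/
def lift {V : Type} {N : ℕ} (proj : V → Fin (N + 1)) (φ : Fin (N + 1) → ℂ) : V → ℂ :=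
  fun x => φ (proj x)

/-- `deg₊(x)`: the number of neighbors of `x` in the next layer. -/
def degPlus {V : Type} [Fintype V] {N : ℕ} (proj : V → Fin (N + 1))
    (Adj : V → V → Prop) [DecidableRel Adj] (x : V) : ℕ :=
  (Finset.univ.filter (fun y => Adj x y ∧ (proj y : ℕ) = (proj x : ℕ) + 1)).card

/-- `deg₋(x)`: the number of neighbors of `x` in the previous layer. -/
def degMinus {V : Type} [Fintype V] {N : ℕ} (proj : V → Fin (N + 1))
    (Adj : V → V → Prop) [DecidableRel Adj] (x : V) : ℕ :=
  (Finset.univ.filter (fun y => Adj x y ∧ (proj y : ℕ) + 1 = (proj x : ℕ))).card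

lemma innerG_single_mulVec_single {V : Type} [Fintype V] [DecidableEq V] {N : ℕ}
    (proj : V → Fin (N + 1)) (H : Matrix V V ℂ) (x y : V) :
    innerG proj (Pi.single x 1) (H.mulVec (Pi.single y 1)) =
      (starRingEnd ℂ) (H x y) * mu proj x := by
  simp [innerG, Pi.single_apply]

lemma mu_ne_zero {V : Type} [Fintype V] {N : ℕ} (proj : V → Fin (N + 1)) (x : V) :
    mu proj x ≠ 0 := by
  have hx : x ∈ layer proj (proj x) := by simp [layer]
  exact inv_ne_zero (Nat.cast_ne_zero.mpr (Finset.card_ne_zero_of_mem hx))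

/-- If the rows of `H` indexed by the layer of `x` each sum to `c` over the layer `m`, then
`c` is the corresponding entry of the reduced operator. -/
lemma avg_mulVec_lift_single {V : Type} [Fintype V] {N : ℕ} (proj : V → Fin (N + 1))
    (H : Matrix V V ℂ) (x : V) (m : Fin (N + 1)) (c : ℂ)
    (h : ∀ w, proj w = proj x → ∑ z ∈ layer proj m, H w z = c) :
    avg proj (H.mulVec (lift proj (Pi.single m 1))) (proj x) = c := by
  have hrow : ∀ w ∈ layer proj (proj x), H.mulVec (lift proj (Pi.single m 1)) w = c := by
    intro w hw
    rw [← h w (by simpa [layer] using hw)]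
    simp [Matrix.mulVec, dotProduct, lift, Pi.single_apply, layer, Finset.sum_filter]
  have hcard : ((layer proj (proj x)).card : ℂ) ≠ 0 :=
    fun h => mu_ne_zero proj x (by rw [mu, h, inv_zero])
  rw [avg, Finset.sum_congr rfl hrow, Finset.sum_const, nsmul_eq_mul, inv_mul_cancel_left₀ hcard]

/-- The off-diagonal entries of `H` between two layers are determined by the reduced operator
and the number `d` of neighbors that each vertex of the first layer has in the second. -/
lemma entry_eq_inv_mul_avg {V : Type} [Fintype V] {N : ℕ} (proj : V → Fin (N + 1))
    (Adj : V → V → Prop) [DecidableRel Adj] (H : Matrix V V ℂ)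
    (hNN : ∀ x y, x ≠ y → ¬ Adj x y → H x y = 0) (x y : V) (hxy : Adj x y)
    (hne : proj x ≠ proj y)
    (hconst : ∀ w z, Adj w z → proj w = proj x → proj z = proj y → H w z = H x y) (d : ℕ)
    (hd : ∀ w, proj w = proj x → ((layer proj (proj y)).filter (Adj w)).card = d) :
    H x y = (d : ℂ)⁻¹ * avg proj (H.mulVec (lift proj (Pi.single (proj y) 1))) (proj x) := by
  have hd0 : (d : ℂ) ≠ 0 := by
    rw [← hd x rfl]
    exact Nat.cast_ne_zero.mpr (Finset.card_ne_zero_of_mem (a := y) (by simp [layer, hxy]))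
  rw [avg_mulVec_lift_single proj H x (proj y) (d * H x y), inv_mul_cancel_left₀ hd0]
  intro w hw
  have hrow : ∀ z ∈ layer proj (proj y), H w z = if Adj w z then H x y else 0 := by
    intro z hz
    have hz' : proj z = proj y := by simpa [layer] using hz
    split_ifs with hwz
    · exact hconst w z hwz hw hz'
    · exact hNN w z (fun h => hne (by rw [← hw, h, hz'])) hwz
  rw [Finset.sum_congr rfl hrow, ← Finset.sum_filter, Finset.sum_const, hd w hw, nsmul_eq_mul]

/-- Proposition 1, part 2: for adjacent vertices `x, y`, the off-diagonal
matrix entry of the Hamiltonian is the corresponding entry of the reduced operator divided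
by the directed degree: if `Π y = Π x + 1` then `H(x,y) = (1/deg₊(x)) (J δ_{Π x + 1})(Π x)`,
and if `Π x = Π y + 1` then `H(x,y) = (1/deg₋(x)) (J δ_{Π x - 1})(Π x)`. -/
theorem hamiltonian_offdiagonal_entry
    (V : Type) [Fintype V] [DecidableEq V] [Nonempty V]
    (N : ℕ) (hN : 1 ≤ N)
    (proj : V → Fin (N + 1)) (hsurj : Function.Surjective proj)
    (Adj : V → V → Prop) [DecidableRel Adj]
    (hAdjSymm : Symmetric Adj) (hAdjIrrefl : Irreflexive Adj)
    (hlayeredge : ∀ x y, Adj x y →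
      (proj y : ℕ) = (proj x : ℕ) + 1 ∨ (proj x : ℕ) = (proj y : ℕ) + 1)
    (hdegp : ∀ x y, proj x = proj y → degPlus proj Adj x = degPlus proj Adj y)
    (hdegm : ∀ x y, proj x = proj y → degMinus proj Adj x = degMinus proj Adj y)
    (xL xR : V)
    (hxL : layer proj 0 = {xL})
    (hxR : layer proj (Fin.last N) = {xR})
    (H : Matrix V V ℂ)
    (hNN : ∀ x y, x ≠ y → ¬ Adj x y → H x y = 0)
    (hSymCoup : ∀ x₁ y₁ x₂ y₂, Adj x₁ y₁ → Adj x₂ y₂ →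
      proj x₁ = proj x₂ → proj y₁ = proj y₂ →
      innerG proj (Pi.single x₁ 1) (H.mulVec (Pi.single y₁ 1)) =
        innerG proj (Pi.single x₂ 1) (H.mulVec (Pi.single y₂ 1)))
    (hDiag : ∀ x y, proj x = proj y →
      innerG proj (Pi.single x 1) (H.mulVec (Pi.single x 1)) =
        innerG proj (Pi.single y 1) (H.mulVec (Pi.single y 1)))
    (J : Matrix (Fin (N + 1)) (Fin (N + 1)) ℂ)
    (hJ : ∀ φ, J.mulVec φ = avg proj (H.mulVec (lift proj φ)))
    (x y : V) (hxy : Adj x y) :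
    ((proj y : ℕ) = (proj x : ℕ) + 1 →
      H x y = ((degPlus proj Adj x : ℂ))⁻¹ *
        J.mulVec (Pi.single (proj y) (1 : ℂ)) (proj x)) ∧
    ((proj x : ℕ) = (proj y : ℕ) + 1 →
      H x y = ((degMinus proj Adj x : ℂ))⁻¹ *
        J.mulVec (Pi.single (proj y) (1 : ℂ)) (proj x)) := by
  have hconst : ∀ w z, Adj w z → proj w = proj x → proj z = proj y → H w z = H x y := by
    intro w z hwz hw hz
    have h := hSymCoup w z x y hwz hxy hw hz
    have hmu : mu proj w = mu proj x := by simp [mu, hw]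
    rw [innerG_single_mulVec_single, innerG_single_mulVec_single, hmu] at h
    exact (starRingEnd ℂ).injective (mul_right_cancel₀ (mu_ne_zero proj x) h)
  rw [hJ]
  constructor <;> intro hlayer
  · refine entry_eq_inv_mul_avg proj Adj H hNN x y hxy (fun h => ?_) hconst _ (fun w hw => ?_)
    · rw [h] at hlayer
      omega
    · rw [← hdegp w x hw, degPlus, layer, Finset.filter_filter]
      congr 1
      ext z
      simp only [Finset.mem_filter, Finset.mem_univ, true_and, Fin.ext_iff, hw, hlayer]
      tauto
  · refine entry_eq_inv_mul_avg proj Adj H hNN x y hxy (fun h => ?_) hconst _ (fun w hw => ?_)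
    · rw [h] at hlayer
      omega
    · rw [← hdegm w x hw, degMinus, layer, Finset.filter_filter]
      congr 1
      ext z
      simp only [Finset.mem_filter, Finset.mem_univ, true_and, Fin.ext_iff, hw, hlayer,
        Nat.add_right_cancel_iff]
      tauto
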